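/- arXiv:1802.02352 — 2 statements merged into one kernel-verified Lean document; each statement's English description precedes it below -/
import Mathlib

section
/- Let Ṽ be a family satisfying (V1)–(V3) and l : 𝒵_Ṽ → 𝒵 a linear isomorphism such that l(𝒫_Ṽ) = 𝒬 and Δ^Ṽ_{s*}(x) = δ_s(l(x)) for x ∈ 𝒫_Ṽ, where s* = (s_r,…,s_1); let l* : 𝒵 → 𝒵_Ṽ be the adjoint of l with respect to the trace inner products, so that l*(𝒫) = 𝒬_Ṽ. Let s ∈ Ξ with s_k > 0 for all k, let R_s be the Riesz measure on 𝒵 with Laplace transform δ_{−s} on 𝒬, and let R*_{s*} be the Riesz measure on 𝒵_Ṽ with Laplace transform Δ^Ṽ_{−s*} on 𝒫_Ṽ. Then the variance function of F(R_s) is given by V_{F(R_s)}(θ) = (l*)^{−1} ∘ V_{F(R*_{s*})}(l*(θ)) ∘ l^{−1} for every θ ∈ 𝒫 = M_{F(R_s)}. -/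
open Matrix MeasureTheory Finset
open scoped ENNReal

namespace Wishart

instance {m n α : Type*} [MeasurableSpace α] : MeasurableSpace (Matrix m n α) :=
  inferInstanceAs (MeasurableSpace (m → n → α))

/-- Index set of an `N × N` matrix partitioned into `r + 1` blocks of sizes `n 0, …, n r`. -/
abbrev Idx (r : ℕ) (n : Fin (r + 1) → ℕ+) := Σ k : Fin (r + 1), Fin (n k)

/-- Real matrices over the partitioned index set. -/
abbrev Mat (r : ℕ) (n : Fin (r + 1) → ℕ+) := Matrix (Idx r n) (Idx r n) ℝ

variable {r : ℕ} {n : Fin (r + 1) → ℕ+}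

/-- The `(l,k)` block of a partitioned matrix. -/
def blk (x : Mat r n) (l k : Fin (r + 1)) : Matrix (Fin (n l)) (Fin (n k)) ℝ :=
  Matrix.of fun a b => x ⟨l, a⟩ ⟨k, b⟩

variable (V : ∀ l k : Fin (r + 1), Submodule ℝ (Matrix (Fin (n l)) (Fin (n k)) ℝ))

/-- Condition (V1): `A ∈ 𝒱_{lk}`, `B ∈ 𝒱_{ki}` implies `A B ∈ 𝒱_{li}` for `i < k < l`. -/
def CondV1 : Prop := ∀ i k l : Fin (r + 1), i < k → k < l →
  ∀ A ∈ V l k, ∀ B ∈ V k i, A * B ∈ V l i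

/-- Condition (V2): `A ∈ 𝒱_{li}`, `B ∈ 𝒱_{ki}` implies `A Bᵀ ∈ 𝒱_{lk}` for `i < k < l`. -/
def CondV2 : Prop := ∀ i k l : Fin (r + 1), i < k → k < l →
  ∀ A ∈ V l i, ∀ B ∈ V k i, A * Bᵀ ∈ V l k

/-- Condition (V3): `A ∈ 𝒱_{lk}` implies `A Aᵀ ∈ ℝ I`. -/
def CondV3 : Prop := ∀ k l : Fin (r + 1), k < l →
  ∀ A ∈ V l k, ∃ c : ℝ, A * Aᵀ = c • (1 : Matrix (Fin (n l)) (Fin (n l)) ℝ)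

/-- The space `𝒵` of symmetric matrices with lower blocks in `𝒱_{lk}` and scalar diagonal
blocks. -/
def Zspace : Set (Mat r n) :=
  {x | x.IsSymm ∧ (∀ k l : Fin (r + 1), k < l → blk x l k ∈ V l k) ∧
    ∀ k : Fin (r + 1), ∃ c : ℝ, ∀ a b : Fin (n k),
      x ⟨k, a⟩ ⟨k, b⟩ = if a = b then c else 0}

/-- The trace inner product `⟨x, y⟩ = tr (x y)`. -/
def tip (x y : Mat r n) : ℝ := (x * y).trace

/-- The homogeneous cone `𝒫 = 𝒵 ∩ Sym₊(N, ℝ)`. -/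
def Pcone : Set (Mat r n) := {x | x ∈ Zspace V ∧ x.PosDef}

/-- The dual cone `𝒬 = {ξ ∈ 𝒵 : ⟨ξ, x⟩ > 0 for all nonzero x in the closure of 𝒫}`. -/
def Qcone : Set (Mat r n) :=
  {ξ | ξ ∈ Zspace V ∧ ∀ x ∈ closure (Pcone V), x ≠ 0 → 0 < tip ξ x}

/-- The group `H` of block lower triangular matrices with strictly lower blocks in `𝒱_{lk}`
and positive scalar diagonal blocks. -/
def Hgrp : Set (Mat r n) :=
  {T | (∀ k l : Fin (r + 1), l < k → blk T l k = 0) ∧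
    (∀ k l : Fin (r + 1), k < l → blk T l k ∈ V l k) ∧
    ∀ k : Fin (r + 1), ∃ t : ℝ, 0 < t ∧ ∀ a b : Fin (n k),
      T ⟨k, a⟩ ⟨k, b⟩ = if a = b then t else 0}

/-- `ρ(T) x = T x Tᵀ`. -/
def rhoM (T x : Mat r n) : Mat r n := T * x * Tᵀ

/-- The diagonal scalar `t_{kk}` of a matrix with scalar diagonal blocks. -/
def tdiag (T : Mat r n) (k : Fin (r + 1)) : ℝ :=
  T ⟨k, ⟨0, (n k).2⟩⟩ ⟨k, ⟨0, (n k).2⟩⟩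

/-- The one-dimensional representation `χ_s(T) = ∏_k t_{kk}^{2 s_k}`. -/
noncomputable def chi (s : Fin (r + 1) → ℝ) (T : Mat r n) : ℝ :=
  ∏ k : Fin (r + 1), tdiag T k ^ (2 * s k)

/-- `½ Σ_{i<k} ε_i dim 𝒱_{ki}`. -/
noncomputable def xiBound (ε : Fin (r + 1) → Bool) (k : Fin (r + 1)) : ℝ :=
  (1 / 2) * ∑ i ∈ Finset.univ.filter (fun i => i < k),
    (if ε i then (Module.finrank ℝ (V k i) : ℝ) else 0)

/-- The Gindikin set `Ξ`. -/
def XiSet : Set (Fin (r + 1) → ℝ) :=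
  ⋃ ε : Fin (r + 1) → Bool,
    {s | ∀ k, (ε k = true → xiBound V ε k < s k) ∧ (ε k = false → s k = xiBound V ε k)}

/-- `½ Σ_{l>k} ε_l dim 𝒱_{lk}`. -/
noncomputable def frakBound (ε : Fin (r + 1) → Bool) (k : Fin (r + 1)) : ℝ :=
  (1 / 2) * ∑ l ∈ Finset.univ.filter (fun l => k < l),
    (if ε l then (Module.finrank ℝ (V l k) : ℝ) else 0)

/-- The Gindikin set `𝔛`. -/
def frakX : Set (Fin (r + 1) → ℝ) :=
  ⋃ ε : Fin (r + 1) → Bool,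
    {s | ∀ k, (ε k = true → frakBound V ε k < s k) ∧ (ε k = false → s k = frakBound V ε k)}

/-- Laplace transform `L_μ(θ) = ∫ e^{-⟨θ,x⟩} dμ(x)` (with values in `[0,∞]`). -/
noncomputable def laplace (μ : Measure (Mat r n)) (θ : Mat r n) : ℝ≥0∞ :=
  ∫⁻ x, ENNReal.ofReal (Real.exp (-(tip θ x))) ∂μ

/-- Real-valued Laplace transform. -/
noncomputable def laplaceR (μ : Measure (Mat r n)) (θ : Mat r n) : ℝ :=
  ∫ x, Real.exp (-(tip θ x)) ∂μ

/-- Mean of the natural-exponential-family member `P(θ,μ)`, computed entrywise: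
`m_μ(θ) = L_μ(θ)⁻¹ ∫ x e^{-⟨θ,x⟩} dμ(x)`. -/
noncomputable def meanMap (μ : Measure (Mat r n)) (θ : Mat r n) : Mat r n :=
  Matrix.of fun p q => (laplaceR μ θ)⁻¹ * ∫ x, Real.exp (-(tip θ x)) * x p q ∂μ

/-- Covariance operator of `P(θ,μ)` with mean `m`, applied to `ξ ∈ 𝒵` (entrywise):
`V ξ = ∫ ⟨ξ, x - m⟩ (x - m) dP(θ,μ)(x)`. -/
noncomputable def varOp (μ : Measure (Mat r n)) (θ m ξ : Mat r n) : Mat r n :=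
  Matrix.of fun p q =>
    (laplaceR μ θ)⁻¹ * ∫ x, Real.exp (-(tip θ x)) * tip ξ (x - m) * ((x - m) p q) ∂μ

/-- Leading principal submatrix `y_{{1:k}}` consisting of the blocks with indices `≤ k`. -/
def lead (k : Fin (r + 1)) (y : Mat r n) :
    Matrix {p : Idx r n // p.1 ≤ k} {p : Idx r n // p.1 ≤ k} ℝ :=
  Matrix.of fun p q => y p.1 q.1

/-- Zero-padding `z₀` of a matrix `z` defined on the blocks with indices `≤ k`. -/
def pad (k : Fin (r + 1)) (z : Matrix {p : Idx r n // p.1 ≤ k} {p : Idx r n // p.1 ≤ k} ℝ) :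
    Mat r n :=
  Matrix.of fun p q => if h : p.1 ≤ k ∧ q.1 ≤ k then z ⟨p, h.1⟩ ⟨q, h.2⟩ else 0

/-- `J_k = (I_{N_k})₀`. -/
def Jmat (k : Fin (r + 1)) : Mat r n := pad k 1

/-- Parameters of elements of `W_i`: the scalar `x_{ii}` and the blocks `X_{li}`. -/
abbrev Wparam (r : ℕ) (n : Fin (r + 1) → ℕ+) (i : Fin (r + 1)) :=
  ℝ × ∀ l : Fin (r + 1), Matrix (Fin (n l)) (Fin (n i)) ℝ

/-- The `N × n_i` matrix in `W_i` with `i`-th block row `x_{ii} I` and `l`-th block row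
`X_{li}` for `l > i`. -/
def toW (i : Fin (r + 1)) (p : Wparam r n i) : Matrix (Idx r n) (Fin (n i)) ℝ :=
  Matrix.of fun q b =>
    if q.1 = i then (if (q.2 : ℕ) = (b : ℕ) then p.1 else 0)
    else if i < q.1 then p.2 q.1 q.2 b else 0

/-- A parameter tuple gives an honest element of `W_i`: blocks lie in `𝒱_{li}` and vanish
for `l ≤ i`. -/
def WGood (i : Fin (r + 1)) (p : Wparam r n i) : Prop :=
  (∀ l : Fin (r + 1), i < l → p.2 l ∈ V l i) ∧ (∀ l : Fin (r + 1), ¬ i < l → p.2 l = 0)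

/-- The inner product `(A|B)` on `𝒱_{lk}`, characterized by `(ABᵀ + BAᵀ)/2 = (A|B) I`. -/
noncomputable def bip (l : Fin (r + 1)) {k : Fin (r + 1)}
    (A B : Matrix (Fin (n l)) (Fin (n k)) ℝ) : ℝ :=
  (A * Bᵀ).trace / (n l : ℝ)

open scoped Classical in
/-- The generalized power function `Δ_s` on `𝒫`, defined by `Δ_s(ρ(T) I) = χ_s(T)`. -/
noncomputable def DeltaDef (s : Fin (r + 1) → ℝ) (x : Mat r n) : ℝ :=
  if h : ∃ T, T ∈ Hgrp V ∧ x = rhoM T 1 then chi s h.choose else 0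

/-- Index set for the block diagonal matrix `Φ(ξ) = diag(φ_0(ξ), …, φ_r(ξ))`,
where `φ_i(ξ)` is of size `m_i = mdc i + 1`. -/
abbrev DIdx (r : ℕ) (mdc : Fin (r + 1) → ℕ) := Σ i : Fin (r + 1), Fin (mdc i + 1)

/-- The block diagonal matrix `Φ(ξ) = diag(φ_0(ξ), …, φ_r(ξ))`. -/
def PhiMat {mdc : Fin (r + 1) → ℕ}
    (φ : ∀ i : Fin (r + 1), Mat r n → Matrix (Fin (mdc i + 1)) (Fin (mdc i + 1)) ℝ)
    (ξ : Mat r n) : Matrix (DIdx r mdc) (DIdx r mdc) ℝ :=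
  Matrix.of fun p q =>
    if h : p.1 = q.1 then φ p.1 ξ p.2 (Fin.cast (by rw [h]) q.2) else 0

/-- `Φ(I_N)^{-1/2}`: the inverse square root of the (diagonal, positive) matrix `Φ(I_N)`. -/
noncomputable def PhiISqrtInv {mdc : Fin (r + 1) → ℕ}
    (φ : ∀ i : Fin (r + 1), Mat r n → Matrix (Fin (mdc i + 1)) (Fin (mdc i + 1)) ℝ) :
    Matrix (DIdx r mdc) (DIdx r mdc) ℝ :=
  Matrix.diagonal fun p => (PhiMat φ (1 : Mat r n) p p) ^ (-(1 / 2) : ℝ)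

open ProbabilityTheory Filter Topology

/-- A matrix that is positive definite stays so under small symmetric perturbations. -/
theorem eventually_posDef_add_smul {ι : Type*} [Fintype ι] {x y : Matrix ι ι ℝ}
    (hx : x.PosDef) (hy : y.IsSymm) : ∀ᶠ t : ℝ in 𝓝 0, (x + t • y).PosDef := by
  have hsph : IsCompact (Metric.sphere (0 : ι → ℝ) 1) := isCompact_sphere 0 1
  have hev : ∀ᶠ t : ℝ in 𝓝 0, ∀ v ∈ Metric.sphere (0 : ι → ℝ) 1,
      0 < v ⬝ᵥ ((x + t • y) *ᵥ v) := by
    apply hsph.eventually_forall_of_forall_eventually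
    intro v hv
    have hv0 : v ≠ 0 := ne_zero_of_mem_unit_sphere ⟨v, hv⟩
    have hcont : Continuous fun z : ℝ × (ι → ℝ) => z.2 ⬝ᵥ ((x + z.1 • y) *ᵥ z.2) := by
      fun_prop
    have h0 : (0 : ℝ) < v ⬝ᵥ ((x + (0 : ℝ) • y) *ᵥ v) := by
      simpa using hx.dotProduct_mulVec_pos hv0
    exact hcont.continuousAt.eventually (lt_mem_nhds (b := ((0 : ℝ), v).2 ⬝ᵥ _) h0)
  filter_upwards [hev] with t ht
  refine Matrix.PosDef.of_dotProduct_mulVec_pos ?_ ?_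
  · have hxs : xᵀ = x := by simpa [Matrix.IsHermitian] using hx.isHermitian
    simp [Matrix.IsHermitian, hxs, hy.eq]
  · intro v hv
    have hn : 0 < ‖v‖ := norm_pos_iff.mpr hv
    have h := ht (‖v‖⁻¹ • v) (by simp [norm_smul, hn.ne'])
    rw [mulVec_smul, smul_dotProduct, dotProduct_smul, smul_eq_mul, smul_eq_mul,
      ← mul_assoc] at h
    simpa using (pos_iff_pos_of_mul_pos h).1 (by positivity)

theorem tip_eq_sum (x y : Mat r n) : tip x y = ∑ p, ∑ q, x p q * y q p := rfl

theorem tip_add_left (x y z : Mat r n) : tip (x + y) z = tip x z + tip y z := by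
  simp [tip, add_mul]

theorem tip_add_right (x y z : Mat r n) : tip x (y + z) = tip x y + tip x z := by
  simp [tip, mul_add]

theorem tip_sub_right (x y z : Mat r n) : tip x (y - z) = tip x y - tip x z := by
  simp [tip, mul_sub]

theorem tip_sub_left (x y z : Mat r n) : tip (x - y) z = tip x z - tip y z := by
  simp [tip, sub_mul]

theorem tip_smul_left (c : ℝ) (x y : Mat r n) : tip (c • x) y = c * tip x y := by
  simp [tip]

theorem tip_smul_right (c : ℝ) (x y : Mat r n) : tip x (c • y) = c * tip x y := by
  simp [tip]

theorem tip_sum_right {ι : Type*} (t : Finset ι) (x : Mat r n) (f : ι → Mat r n) :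
    tip x (∑ i ∈ t, f i) = ∑ i ∈ t, tip x (f i) := by
  simp [tip, Finset.mul_sum, Matrix.trace_sum]

theorem tip_comm (x y : Mat r n) : tip x y = tip y x := Matrix.trace_mul_comm x y

@[fun_prop]
theorem measurable_tip (x : Mat r n) : Measurable (tip x) := by
  have h : ∀ p q, Measurable fun y : Mat r n => y p q := fun p q =>
    (measurable_pi_apply q).comp (measurable_pi_apply (X := fun _ => Idx r n → ℝ) p)
  simp only [funext (tip_eq_sum x)]
  fun_prop

theorem eq_zero_of_tip_self {x : Mat r n} (hx : x.IsSymm) (h : tip x x = 0) : x = 0 := by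
  rw [← Matrix.trace_conjTranspose_mul_self_eq_zero_iff]
  simpa [hx.eq, tip] using h

/-- `𝒵` as a linear subspace. -/
def Zsub : Submodule ℝ (Mat r n) where
  carrier := Zspace V
  zero_mem' := ⟨by simp [Matrix.IsSymm], fun k l _ => (V l k).zero_mem, fun k => ⟨0, by simp⟩⟩
  add_mem' := by
    rintro x y ⟨hx, hx', hx''⟩ ⟨hy, hy', hy''⟩
    refine ⟨hx.add hy, fun k l h => (V l k).add_mem (hx' k l h) (hy' k l h), fun k => ?_⟩
    obtain ⟨c, hc⟩ := hx'' k
    obtain ⟨d, hd⟩ := hy'' k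
    exact ⟨c + d, fun a b => by rw [Matrix.add_apply, hc, hd]; split_ifs <;> simp⟩
  smul_mem' := by
    rintro t x ⟨hx, hx', hx''⟩
    refine ⟨hx.smul t, fun k l h => (V l k).smul_mem t (hx' k l h), fun k => ?_⟩
    obtain ⟨c, hc⟩ := hx'' k
    exact ⟨t * c, fun a b => by rw [Matrix.smul_apply, hc]; split_ifs <;> simp⟩

variable {V}

theorem eventually_mem_Pcone {x y : Mat r n} (hx : x ∈ Pcone V) (hy : y ∈ Zsub V) :
    ∀ᶠ t : ℝ in 𝓝 0, x + t • y ∈ Pcone V := by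
  filter_upwards [eventually_posDef_add_smul hx.2 hy.1] with t ht
  exact ⟨(Zsub V).add_mem hx.1 ((Zsub V).smul_mem t hy), ht⟩

theorem eq_of_tip_eq {x y : Mat r n} (hx : x ∈ Zsub V) (hy : y ∈ Zsub V)
    (h : ∀ z ∈ Zsub V, tip z x = tip z y) : x = y := by
  have hxy := (Zsub V).sub_mem hx hy
  refine sub_eq_zero.1 (eq_zero_of_tip_self hxy.1 ?_)
  rw [tip_sub_right, h _ hxy, sub_self]

variable (V) in
/-- The trace form on `𝒵` admits dual bases. -/
theorem exists_dual_basis : ∃ (m : ℕ) (d b : Fin m → Mat r n), (∀ i, d i ∈ Zsub V) ∧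
    (∀ i, b i ∈ Zsub V) ∧ ∀ x ∈ Zsub V, x = ∑ i, tip (d i) x • b i := by
  let B : LinearMap.BilinForm ℝ (Zsub V) := LinearMap.mk₂ ℝ (fun x y => tip x.1 y.1)
    (fun x y z => tip_add_left _ _ _) (fun c x y => tip_smul_left _ _ _)
    (fun x y z => tip_add_right _ _ _) (fun c x y => tip_smul_right _ _ _)
  have hB : B.Nondegenerate := by
    constructor
    · intro x hx
      exact Subtype.ext (eq_zero_of_tip_self x.2.1 (hx x))
    · intro x hx
      exact Subtype.ext (eq_zero_of_tip_self x.2.1 (hx x))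
  let e := Module.finBasis ℝ (Zsub V)
  refine ⟨_, fun i => (e i).1, fun i => (B.dualBasis hB e i).1, fun i => (e i).2,
    fun i => (B.dualBasis hB e i).2, fun x hx => ?_⟩
  have h := congrArg Subtype.val ((B.dualBasis hB e).sum_repr ⟨x, hx⟩)
  simp only [LinearMap.BilinForm.dualBasis_repr_apply] at h
  rw [AddSubmonoidClass.coe_finsetSum] at h
  refine h.symm.trans (Finset.sum_congr rfl fun i _ => ?_)
  simp only [SetLike.val_smul, B, LinearMap.mk₂_apply]
  rw [tip_comm]

/-- The entrywise integral of a weakly integrable `𝒵`-valued function lies in `𝒵` and is also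
its weak integral. -/
theorem entrywise_integral {P : Measure (Mat r n)} {F : Mat r n → Mat r n}
    (hF : ∀ᵐ x ∂P, F x ∈ Zsub V) (hint : ∀ z ∈ Zsub V, Integrable (fun x => tip z (F x)) P) :
    (Matrix.of fun p q => ∫ x, F x p q ∂P) ∈ Zsub V ∧
      ∀ z ∈ Zsub V, tip z (Matrix.of fun p q => ∫ x, F x p q ∂P) = ∫ x, tip z (F x) ∂P := by
  obtain ⟨m, d, b, hd, hb, hdb⟩ := exists_dual_basis V
  have key : (Matrix.of fun p q => ∫ x, F x p q ∂P) = ∑ i, (∫ x, tip (d i) (F x) ∂P) • b i := by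
    ext p q
    simp only [Matrix.of_apply, Matrix.sum_apply, Matrix.smul_apply, smul_eq_mul]
    simp_rw [← integral_mul_const]
    rw [← integral_finsetSum _ fun i _ => (hint _ (hd i)).mul_const _]
    refine integral_congr_ae ?_
    filter_upwards [hF] with x hx
    conv_lhs => rw [hdb _ hx]
    simp [Matrix.sum_apply]
  rw [key]
  refine ⟨Submodule.sum_mem _ fun i _ => (Zsub V).smul_mem _ (hb i), fun z hz => ?_⟩
  rw [tip_sum_right]
  simp_rw [tip_smul_right, ← integral_mul_const]
  rw [← integral_finsetSum _ fun i _ => (hint _ (hd i)).mul_const _]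
  refine integral_congr_ae ?_
  filter_upwards [hF] with x hx
  conv_rhs => rw [hdb _ hx]
  simp [tip_sum_right, tip_smul_right]

/-- The member `P(θ, μ)` of the natural exponential family generated by `μ`. -/
noncomputable abbrev nef (μ : Measure (Mat r n)) (θ : Mat r n) : Measure (Mat r n) :=
  μ.tilted fun x => -(tip θ x)

theorem integral_nef (μ : Measure (Mat r n)) (θ : Mat r n) (g : Mat r n → ℝ) :
    ∫ x, g x ∂(nef μ θ) = (laplaceR μ θ)⁻¹ * ∫ x, Real.exp (-(tip θ x)) * g x ∂μ := by
  rw [nef, integral_tilted, ← integral_const_mul]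
  refine integral_congr_ae (ae_of_all _ fun x => ?_)
  simp only [laplaceR, smul_eq_mul]
  ring

theorem meanMap_eq (μ : Measure (Mat r n)) (θ : Mat r n) :
    meanMap μ θ = Matrix.of fun p q => ∫ x, x p q ∂(nef μ θ) := by
  ext p q
  rw [Matrix.of_apply, integral_nef]
  rfl

theorem varOp_eq (μ : Measure (Mat r n)) (θ m ξ : Mat r n) :
    varOp μ θ m ξ = Matrix.of fun p q => ∫ x, (tip ξ (x - m) • (x - m)) p q ∂(nef μ θ) := by
  ext p q
  rw [Matrix.of_apply, integral_nef]
  simp only [varOp, Matrix.of_apply, Matrix.smul_apply, smul_eq_mul, mul_assoc]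

theorem integrable_exp_of_laplace_ne_top {μ : Measure (Mat r n)} {θ : Mat r n}
    (h : laplace μ θ ≠ ∞) : Integrable (fun x => Real.exp (-(tip θ x))) μ := by
  refine (lintegral_ofReal_ne_top_iff_integrable (by fun_prop) ?_).1 h
  exact ae_of_all _ fun x => (Real.exp_pos _).le

theorem laplaceR_eq (μ : Measure (Mat r n)) (θ : Mat r n) :
    laplaceR μ θ = (laplace μ θ).toReal :=
  integral_eq_lintegral_of_nonneg_ae (ae_of_all _ fun x => (Real.exp_pos _).le)
    (by fun_prop)

theorem mgf_nef (μ : Measure (Mat r n)) (θ ξ : Mat r n) (t : ℝ) :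
    mgf (tip ξ) (nef μ θ) t = laplaceR μ (θ + (-t) • ξ) / laplaceR μ θ := by
  rw [mgf, nef, integral_exp_tilted]
  simp only [laplaceR]
  congr 2
  ext x
  simp only [Pi.add_apply, tip_add_left, tip_smul_left]
  ring_nf

theorem mem_interior_integrableExpSet {μ : Measure (Mat r n)} {θ ξ : Mat r n}
    (h : ∀ᶠ t : ℝ in 𝓝 0, laplace μ (θ + t • ξ) ≠ ∞) :
    0 ∈ interior (integrableExpSet (tip ξ) (nef μ θ)) := by
  have h0 : Integrable (fun x => Real.exp (-(tip θ x))) μ :=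
    integrable_exp_of_laplace_ne_top (by simpa using h.self_of_nhds)
  rw [mem_interior_iff_mem_nhds]
  have hneg : Tendsto (fun t : ℝ => -t) (𝓝 0) (𝓝 0) := by
    simpa using (continuous_neg (G := ℝ)).tendsto 0
  filter_upwards [hneg.eventually h] with t ht
  rw [integrableExpSet, Set.mem_ofPred_eq, integrable_tilted_iff h0]
  refine (integrable_exp_of_laplace_ne_top ht).congr (ae_of_all _ fun x => ?_)
  simp only [tip_add_left, tip_smul_left, smul_eq_mul, ← Real.exp_add]
  ring_nf

section NaturalFamily

variable {μ : Measure (Mat r n)} {θ : Mat r n}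

theorem ae_nef_mem (hμ : μ (Zspace V)ᶜ = 0) (θ : Mat r n) : ∀ᵐ x ∂(nef μ θ), x ∈ Zsub V :=
  (tilted_absolutelyContinuous μ _).ae_le (mem_ae_iff.2 hμ)

theorem meanMap_weak (hμ : μ (Zspace V)ᶜ = 0)
    (hθ : ∀ z ∈ Zsub V, ∀ᶠ t : ℝ in 𝓝 0, laplace μ (θ + t • z) ≠ ∞) :
    meanMap μ θ ∈ Zsub V ∧ ∀ z ∈ Zsub V, tip z (meanMap μ θ) = ∫ x, tip z x ∂(nef μ θ) := by
  rw [meanMap_eq]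
  exact entrywise_integral (F := fun x => x) (ae_nef_mem hμ θ) fun z hz =>
    integrable_of_mem_interior_integrableExpSet (mem_interior_integrableExpSet (hθ z hz))

theorem memLp_tip_sub (hθ : ∀ z ∈ Zsub V, ∀ᶠ t : ℝ in 𝓝 0, laplace μ (θ + t • z) ≠ ∞)
    {z : Mat r n} (hz : z ∈ Zsub V) (m : Mat r n) :
    MemLp (fun x => tip z (x - m)) 2 (nef μ θ) := by
  simp_rw [tip_sub_right]
  exact (memLp_of_mem_interior_integrableExpSet
    (mem_interior_integrableExpSet (hθ z hz)) 2).sub (memLp_const _)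

theorem varOp_weak (hμ : μ (Zspace V)ᶜ = 0)
    (hθ : ∀ z ∈ Zsub V, ∀ᶠ t : ℝ in 𝓝 0, laplace μ (θ + t • z) ≠ ∞)
    {m ξ : Mat r n} (hm : m ∈ Zsub V) (hξ : ξ ∈ Zsub V) :
    varOp μ θ m ξ ∈ Zsub V ∧ ∀ z ∈ Zsub V, tip z (varOp μ θ m ξ) =
      ∫ x, tip ξ (x - m) * tip z (x - m) ∂(nef μ θ) := by
  rw [varOp_eq]
  have h := entrywise_integral (V := V) (P := nef μ θ)
    (F := fun x => tip ξ (x - m) • (x - m)) ?_ ?_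
  · simpa only [tip_smul_right] using h
  · filter_upwards [ae_nef_mem hμ θ] with x hx
    exact (Zsub V).smul_mem _ ((Zsub V).sub_mem hx hm)
  · intro z hz
    simp_rw [tip_smul_right]
    exact (memLp_tip_sub hθ hξ m).integrable_mul (memLp_tip_sub hθ hz m)

end NaturalFamily

/-- If the exponential change of density `e^{-u}` does not alter the mean of `u`, then `u` is
almost surely constant. -/
theorem ae_eq_const_of_integral_tilted_eq {Ω : Type*} [MeasurableSpace Ω] {P : Measure Ω}
    [IsProbabilityMeasure P] {u : Ω → ℝ} (hu : Integrable u P)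
    (hexp : Integrable (fun x => Real.exp (-(u x))) P)
    (hu' : Integrable u (P.tilted fun x => -(u x)))
    (h : ∫ x, u x ∂(P.tilted fun x => -(u x)) = ∫ x, u x ∂P) :
    ∃ c : ℝ, ∀ᵐ x ∂P, u x = c := by
  set K := ∫ x, Real.exp (-(u x)) ∂P with hK
  have hKpos : 0 < K := integral_exp_pos hexp
  set c := -Real.log K with hc
  have hdens : ∀ x, Real.exp (-(u x)) / K = Real.exp (c - u x) := fun x => by
    rw [hc, Real.exp_sub, Real.exp_neg, Real.exp_neg, Real.exp_log hKpos]
    field_simp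
  have hi1 : Integrable (fun x => Real.exp (c - u x)) P := by
    simpa only [← hdens] using hexp.div_const K
  have hi2 : Integrable (fun x => Real.exp (c - u x) * u x) P := by
    simp only [← hdens]
    refine (((integrable_tilted_iff hexp u).1 hu').div_const K).congr (ae_of_all _ fun x => ?_)
    simp only [smul_eq_mul]
    ring
  have h1 : ∫ x, Real.exp (c - u x) ∂P = 1 := by
    simp only [← hdens]
    rw [integral_div, div_self hKpos.ne']
  have h2 : ∫ x, Real.exp (c - u x) * u x ∂P = ∫ x, u x ∂P := by
    rw [← h, integral_tilted]
    simp only [← hdens, smul_eq_mul, hK]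
  have hnn : ∀ x, 0 ≤ (u x - c) * (1 - Real.exp (c - u x)) := fun x => by
    rcases le_total c (u x) with hx | hx
    · exact mul_nonneg (by linarith) (by simpa using hx)
    · exact mul_nonneg_of_nonpos_of_nonpos (by linarith) (by simpa using hx)
  have hexpand : (fun x => (u x - c) * (1 - Real.exp (c - u x))) = fun x =>
      (u x - Real.exp (c - u x) * u x) - (c - c * Real.exp (c - u x)) := by
    ext x
    ring
  have hint : Integrable (fun x => (u x - c) * (1 - Real.exp (c - u x))) P := by
    rw [hexpand]
    exact (hu.sub hi2).sub ((integrable_const c).sub (hi1.const_mul c))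
  have hzero : ∫ x, (u x - c) * (1 - Real.exp (c - u x)) ∂P = 0 := by
    rw [hexpand]
    refine (integral_sub (hu.sub hi2) ((integrable_const c).sub (hi1.const_mul c))).trans ?_
    simp only [Pi.sub_apply]
    rw [integral_sub hu hi2, integral_sub (integrable_const c) (hi1.const_mul c),
      integral_const_mul, h1, h2]
    simp
  refine ⟨c, ?_⟩
  filter_upwards [(integral_eq_zero_iff_of_nonneg hnn hint).1 hzero] with x hx
  rcases mul_eq_zero.1 hx with hx | hx
  · linarith
  · have := Real.exp_eq_one_iff (c - u x) |>.1 (by linarith)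
    linarith

/-- The moments of linear functionals under an exponential family are determined by the Laplace
transform along the corresponding line. -/
theorem integral_pow_nef_eq {r' : ℕ} {n' : Fin (r' + 1) → ℕ+} {μ : Measure (Mat r n)}
    {μ' : Measure (Mat r' n')} {θ z : Mat r n} {θ' z' : Mat r' n'}
    (h : ∀ᶠ t : ℝ in 𝓝 0, laplace μ (θ + t • z) ≠ ∞)
    (heq : ∀ᶠ t : ℝ in 𝓝 0, laplace μ (θ + t • z) = laplace μ' (θ' + t • z')) (k : ℕ) :
    ∫ x, tip z x ^ k ∂(nef μ θ) = ∫ x, tip z' x ^ k ∂(nef μ' θ') := by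
  have h' : ∀ᶠ t : ℝ in 𝓝 0, laplace μ' (θ' + t • z') ≠ ∞ := by
    filter_upwards [h, heq] with t ht ht'
    rwa [← ht']
  have h1 := iteratedDeriv_mgf_zero (mem_interior_integrableExpSet h) k
  have h2 := iteratedDeriv_mgf_zero (mem_interior_integrableExpSet h') k
  have hneg : Tendsto (fun t : ℝ => -t) (𝓝 0) (𝓝 0) := by
    simpa using (continuous_neg (G := ℝ)).tendsto 0
  have h0 : laplace μ θ = laplace μ' θ' := by simpa using heq.self_of_nhds
  have hmgf : mgf (tip z) (nef μ θ) =ᶠ[𝓝 0] mgf (tip z') (nef μ' θ') := by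
    filter_upwards [hneg.eventually heq] with t ht
    rw [mgf_nef, mgf_nef, laplaceR_eq, laplaceR_eq, laplaceR_eq, laplaceR_eq, ht, h0]
  simpa [h1, h2] using hmgf.iteratedDeriv_eq k

theorem memLp_tip {μ : Measure (Mat r n)} {θ z : Mat r n}
    (h : ∀ᶠ t : ℝ in 𝓝 0, laplace μ (θ + t • z) ≠ ∞) : MemLp (tip z) 2 (nef μ θ) :=
  memLp_of_mem_interior_integrableExpSet (mem_interior_integrableExpSet h) 2

theorem integral_sub_sq_nef {μ : Measure (Mat r n)} {θ z : Mat r n}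
    (h : ∀ᶠ t : ℝ in 𝓝 0, laplace μ (θ + t • z) ≠ ∞) (c : ℝ) :
    ∫ x, (tip z x - c) ^ 2 ∂(nef μ θ) = ∫ x, tip z x ^ 2 ∂(nef μ θ)
      - 2 * c * ∫ x, tip z x ^ 1 ∂(nef μ θ) + c ^ 2 * ∫ x, tip z x ^ 0 ∂(nef μ θ) := by
  have h2 : Integrable (fun x => tip z x ^ 2) (nef μ θ) := (memLp_tip h).integrable_sq
  have h1 : Integrable (fun x => 2 * c * tip z x ^ 1) (nef μ θ) := by
    simpa using ((memLp_tip h).integrable (by norm_num)).const_mul (2 * c)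
  have h0 : Integrable (fun x => c ^ 2 * tip z x ^ 0) (nef μ θ) := by
    simp
  rw [← integral_const_mul, ← integral_const_mul, ← integral_sub h2 h1]
  refine Eq.trans (integral_congr_ae (ae_of_all _ fun x => ?_)) (integral_add (h2.sub h1) h0)
  simp only
  ring

/-- Covariances under two exponential families whose Laplace transforms correspond under `L`
agree. -/
theorem integral_mul_nef_eq {r' : ℕ} {n' : Fin (r' + 1) → ℕ+}
    {V' : ∀ l k : Fin (r' + 1), Submodule ℝ (Matrix (Fin (n' l)) (Fin (n' k)) ℝ)}
    {μ : Measure (Mat r n)} {μ' : Measure (Mat r' n')} {θ : Mat r n} {θ' : Mat r' n'}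
    (L : Mat r' n' →ₗ[ℝ] Mat r n)
    (h : ∀ z ∈ Zsub V', ∀ᶠ t : ℝ in 𝓝 0, laplace μ (θ + t • L z) ≠ ∞)
    (heq : ∀ z ∈ Zsub V', ∀ᶠ t : ℝ in 𝓝 0,
      laplace μ (θ + t • L z) = laplace μ' (θ' + t • z))
    {y z : Mat r' n'} (hy : y ∈ Zsub V') (hz : z ∈ Zsub V') (a b : ℝ) :
    ∫ x, (tip (L y) x - a) * (tip (L z) x - b) ∂(nef μ θ) =
      ∫ x, (tip y x - a) * (tip z x - b) ∂(nef μ' θ') := by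
  have h' : ∀ z ∈ Zsub V', ∀ᶠ t : ℝ in 𝓝 0, laplace μ' (θ' + t • z) ≠ ∞ := fun z hz => by
    filter_upwards [h z hz, heq z hz] with t ht ht'
    rwa [← ht']
  have hsq : ∀ w ∈ Zsub V', ∀ c : ℝ, ∫ x, (tip (L w) x - c) ^ 2 ∂(nef μ θ) =
      ∫ x, (tip w x - c) ^ 2 ∂(nef μ' θ') := fun w hw c => by
    rw [integral_sub_sq_nef (h w hw), integral_sub_sq_nef (h' w hw)]
    simp only [integral_pow_nef_eq (h w hw) (heq w hw)]
  have hp := (Zsub V').add_mem hy hz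
  have hm := (Zsub V').sub_mem hy hz
  have hpolar : ∀ X Y : ℝ, (X - a) * (Y - b) =
      ((X + Y - (a + b)) ^ 2 - (X - Y - (a - b)) ^ 2) / 4 := fun X Y => by ring
  simp_rw [hpolar, ← tip_add_left, ← tip_sub_left, ← map_add, ← map_sub]
  rw [integral_div, integral_div, integral_sub, integral_sub, hsq _ hp, hsq _ hm]
  · exact ((memLp_tip (h' _ hp)).sub (memLp_const _)).integrable_sq
  · exact ((memLp_tip (h' _ hm)).sub (memLp_const _)).integrable_sq
  · exact ((memLp_tip (h _ hp)).sub (memLp_const _)).integrable_sq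
  · exact ((memLp_tip (h _ hm)).sub (memLp_const _)).integrable_sq

/-- If the mean map of `μ` takes all values in `𝒫` on a set of interior parameters, then it is
injective on the preimage of `𝒫` in that set. -/
theorem eq_of_meanMap_eq {μ : Measure (Mat r n)} (hμ : μ (Zspace V)ᶜ = 0) {Q : Set (Mat r n)}
    (hQZ : Q ⊆ Zspace V)
    (hQ : ∀ ξ ∈ Q, ∀ z ∈ Zsub V, ∀ᶠ t : ℝ in 𝓝 0, laplace μ (ξ + t • z) ≠ ∞)
    (hsurj : ∀ m ∈ Pcone V, ∃ ξ ∈ Q, meanMap μ ξ = m)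
    {ξ₁ ξ₂ : Mat r n} (h₁ : ξ₁ ∈ Q) (h₂ : ξ₂ ∈ Q) {m : Mat r n} (hm : m ∈ Pcone V)
    (hm₁ : meanMap μ ξ₁ = m) (hm₂ : meanMap μ ξ₂ = m) : ξ₁ = ξ₂ := by
  have hexp : ∀ ξ ∈ Q, Integrable (fun x => Real.exp (-(tip ξ x))) μ := fun ξ hξ =>
    integrable_exp_of_laplace_ne_top (by
      simpa using (hQ ξ hξ 0 (Zsub V).zero_mem).self_of_nhds)
  have hμ0 : NeZero μ := by
    refine ⟨fun h0 => ?_⟩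
    have hm0 : m = 0 := by
      rw [← hm₁]
      ext p q
      simp [meanMap, h0]
    have := hm.2.diag_pos (i := ⟨0, ⟨0, (n 0).2⟩⟩)
    simp [hm0] at this
  have hprob : ∀ ξ ∈ Q, IsProbabilityMeasure (nef μ ξ) := fun ξ hξ =>
    isProbabilityMeasure_tilted (hexp ξ hξ)
  have hint : ∀ ξ ∈ Q, ∀ z ∈ Zsub V, Integrable (tip z) (nef μ ξ) := fun ξ hξ z hz =>
    integrable_of_mem_interior_integrableExpSet (mem_interior_integrableExpSet (hQ ξ hξ z hz))
  set η := ξ₂ - ξ₁ with hη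
  have hηZ : η ∈ Zsub V := (Zsub V).sub_mem (hQZ h₂) (hQZ h₁)
  have htilt : (nef μ ξ₁).tilted (fun x => -(tip η x)) = nef μ ξ₂ := by
    rw [nef, tilted_tilted (hexp ξ₁ h₁)]
    congr 1
    ext x
    simp only [Pi.add_apply, hη, tip_sub_left]
    ring
  have := hprob ξ₁ h₁
  obtain ⟨c, hc⟩ := ae_eq_const_of_integral_tilted_eq (P := nef μ ξ₁) (hint ξ₁ h₁ η hηZ)
    (by
      rw [integrable_tilted_iff (hexp ξ₁ h₁)]
      refine (hexp ξ₂ h₂).congr (ae_of_all _ fun x => ?_)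
      simp only [hη, tip_sub_left, smul_eq_mul, ← Real.exp_add]
      ring_nf)
    (by rw [htilt]; exact hint ξ₂ h₂ η hηZ)
    (by
      rw [htilt, ← (meanMap_weak hμ (hQ ξ₂ h₂)).2 η hηZ,
        ← (meanMap_weak hμ (hQ ξ₁ h₁)).2 η hηZ, hm₁, hm₂])
  have hcμ : ∀ᵐ x ∂μ, tip η x = c := (absolutelyContinuous_tilted (hexp ξ₁ h₁)).ae_le hc
  have hconst : ∀ w ∈ Pcone V, tip η w = c := fun w hw => by
    obtain ⟨ξ, hξ, rfl⟩ := hsurj w hw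
    have := hprob ξ hξ
    rw [(meanMap_weak hμ (hQ ξ hξ)).2 η hηZ,
      integral_congr_ae ((tilted_absolutelyContinuous μ _).ae_le hcμ)]
    simp
  have hev : ∀ᶠ t : ℝ in 𝓝[≠] 0, m + t • η ∈ Pcone V :=
    (eventually_mem_Pcone hm hηZ).filter_mono nhdsWithin_le_nhds
  obtain ⟨t, ht, ht0⟩ := (hev.and self_mem_nhdsWithin).exists
  have h1 := hconst _ ht
  rw [tip_add_right, tip_smul_right, hconst m hm, add_eq_left] at h1
  have h2 := eq_zero_of_tip_self hηZ.1 ((mul_eq_zero.1 h1).resolve_left ht0)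
  exact (sub_eq_zero.1 h2).symm

/-- Let `Vt` be a family satisfying (V1)–(V3) and `l : 𝒵_Vt → 𝒵` a linear
isomorphism with `l(𝒫_Vt) = 𝒬` and `Δ^Vt_{s*}(x) = δ_s(l(x))` for `x ∈ 𝒫_Vt`, where
`s* = (s_r, …, s_1)`; let `l*` be the adjoint of `l` (so `l*(𝒫) = 𝒬_Vt`).  Let `s ∈ Ξ` with
all `s_k > 0`, `R_s` the Riesz measure on `𝒵` with Laplace transform `δ_{-s}` on `𝒬`, and
`R*_{s*}` the Riesz measure on `𝒵_Vt` with Laplace transform `Δ^Vt_{-s*}` on `𝒫_Vt`.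
Then the variance function of `F(R_s)` is
`V_{F(R_s)}(θ) = (l*)⁻¹ ∘ V_{F(R*_{s*})}(l*(θ)) ∘ l⁻¹` for every
`θ ∈ 𝒫 = M_{F(R_s)}`. -/
theorem statement15 (r : ℕ) (n : Fin (r + 1) → ℕ+)
    (V : ∀ l k : Fin (r + 1), Submodule ℝ (Matrix (Fin (n l)) (Fin (n k)) ℝ))
    (hV1 : CondV1 V) (hV2 : CondV2 V) (hV3 : CondV3 V)
    (rstar : Mat r n → Mat r n → Mat r n)
    (hrstar : ∀ T ∈ Hgrp V, ∀ ξ ∈ Zspace V, rstar T ξ ∈ Zspace V ∧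
      ∀ x ∈ Zspace V, tip (rstar T ξ) x = tip ξ (rhoM T x))
    (δf : (Fin (r + 1) → ℝ) → Mat r n → ℝ)
    (hδ : ∀ s : Fin (r + 1) → ℝ, ∀ T ∈ Hgrp V, δf s (rstar T 1) = chi s T)
    (nt : Fin (r + 1) → ℕ+)
    (Vt : ∀ l k : Fin (r + 1), Submodule ℝ (Matrix (Fin (nt l)) (Fin (nt k)) ℝ))
    (hVt1 : CondV1 Vt) (hVt2 : CondV2 Vt) (hVt3 : CondV3 Vt)
    (lmap : Mat r nt →ₗ[ℝ] Mat r n)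
    (hlbij : Set.BijOn lmap (Zspace Vt) (Zspace V))
    (hlP : lmap '' Pcone Vt = Qcone V)
    (hlpow : ∀ (s : Fin (r + 1) → ℝ), ∀ x ∈ Pcone Vt,
      DeltaDef Vt (fun k => s k.rev) x = δf s (lmap x))
    (lstar : Mat r n → Mat r nt)
    (hlstar : ∀ θ ∈ Zspace V, lstar θ ∈ Zspace Vt ∧
      ∀ x ∈ Zspace Vt, tip (lstar θ) x = tip θ (lmap x))
    (hlstarP : lstar '' Pcone V = Qcone Vt)
    (linv : Mat r n → Mat r nt)
    (hlinv1 : ∀ x ∈ Zspace Vt, linv (lmap x) = x)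
    (hlinv2 : ∀ y ∈ Zspace V, lmap (linv y) = y)
    (lstarinv : Mat r nt → Mat r n)
    (hlstarinv1 : ∀ θ ∈ Zspace V, lstarinv (lstar θ) = θ)
    (hlstarinv2 : ∀ x ∈ Zspace Vt, lstar (lstarinv x) = x)
    (s : Fin (r + 1) → ℝ) (hs : s ∈ XiSet V) (hspos : ∀ k, 0 < s k)
    (μ : Measure (Mat r n)) (hμsupp : μ (Zspace V)ᶜ = 0)
    (hμL : ∀ ξ ∈ Qcone V, laplace μ ξ = ENNReal.ofReal (δf (-s) ξ))
    (ψ : Mat r n → Mat r n)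
    (hψ : ∀ m ∈ Pcone V, ψ m ∈ Qcone V ∧ meanMap μ (ψ m) = m)
    (μt : Measure (Mat r nt)) (hμtsupp : μt (Zspace Vt)ᶜ = 0)
    (hμtL : ∀ θ ∈ Pcone Vt,
      laplace μt θ = ENNReal.ofReal (DeltaDef Vt (fun k => -(s k.rev)) θ))
    (ψt : Mat r nt → Mat r nt)
    (hψt : ∀ m ∈ Qcone Vt, ψt m ∈ Pcone Vt ∧ meanMap μt (ψt m) = m) :
    ∀ θ ∈ Pcone V, ∀ ξ ∈ Zspace V,
      varOp μ (ψ θ) θ ξ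
        = lstarinv (varOp μt (ψt (lstar θ)) (lstar θ) (linv ξ)) := by
  have hQmem : ∀ x ∈ Pcone Vt, lmap x ∈ Qcone V := fun x hx => hlP ▸ Set.mem_image_of_mem _ hx
  have hlap : ∀ x ∈ Pcone Vt, laplace μ (lmap x) = laplace μt x := fun x hx => by
    rw [hμL _ (hQmem x hx), hμtL x hx, ← hlpow (-s) x hx]
    rfl
  have hline : ∀ x ∈ Pcone Vt, ∀ z ∈ Zsub Vt, ∀ᶠ t : ℝ in 𝓝 0,
      lmap x + t • lmap z ∈ Qcone V ∧
        laplace μ (lmap x + t • lmap z) = laplace μt (x + t • z) := fun x hx z hz => by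
    filter_upwards [eventually_mem_Pcone hx hz] with t ht
    rw [← map_smul, ← map_add]
    exact ⟨hQmem _ ht, hlap _ ht⟩
  have hfin : ∀ ξ ∈ Qcone V, laplace μ ξ ≠ ∞ := fun ξ hξ => by
    rw [hμL ξ hξ]
    exact ENNReal.ofReal_ne_top
  have hQ : ∀ ξ ∈ Qcone V, ∀ z ∈ Zsub V, ∀ᶠ t : ℝ in 𝓝 0, laplace μ (ξ + t • z) ≠ ∞ := by
    intro ξ hξ z hz
    obtain ⟨x, hx, rfl⟩ := hlP.symm ▸ hξ
    obtain ⟨y, hy, rfl⟩ := hlbij.surjOn hz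
    filter_upwards [hline x hx y hy] with t ht
    exact hfin _ ht.1
  intro θ hθ ξ hξ
  obtain ⟨hψQ, hψm⟩ := hψ θ hθ
  have hθt : lstar θ ∈ Qcone Vt := hlstarP ▸ Set.mem_image_of_mem _ hθ
  obtain ⟨hτ, hτm⟩ := hψt _ hθt
  set τ := ψt (lstar θ)
  have hfinL : ∀ z ∈ Zsub Vt, ∀ᶠ t : ℝ in 𝓝 0, laplace μ (lmap τ + t • lmap z) ≠ ∞ :=
    fun z hz => hQ _ (hQmem τ hτ) _ (hlbij.mapsTo hz)
  have heqL : ∀ z ∈ Zsub Vt, ∀ᶠ t : ℝ in 𝓝 0,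
      laplace μ (lmap τ + t • lmap z) = laplace μt (τ + t • z) :=
    fun z hz => (hline τ hτ z hz).mono fun t ht => ht.2
  have hfint : ∀ z ∈ Zsub Vt, ∀ᶠ t : ℝ in 𝓝 0, laplace μt (τ + t • z) ≠ ∞ := fun z hz => by
    filter_upwards [hfinL z hz, heqL z hz] with t ht ht'
    rwa [← ht']
  have hadj : ∀ w ∈ Zsub V, ∀ z ∈ Zsub Vt, tip z (lstar w) = tip (lmap z) w :=
    fun w hw z hz => by rw [tip_comm, (hlstar w hw).2 z hz, tip_comm]
  have hmean : meanMap μ (lmap τ) = θ := by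
    obtain ⟨hmem, hweak⟩ := meanMap_weak hμsupp (hQ _ (hQmem τ hτ))
    refine eq_of_tip_eq hmem hθ.1 fun w hw => ?_
    obtain ⟨z, hz, rfl⟩ := hlbij.surjOn hw
    rw [hweak _ hw, ← hadj θ hθ.1 z hz, ← hτm, (meanMap_weak hμtsupp hfint).2 z hz]
    simpa using integral_pow_nef_eq (hfinL z hz) (heqL z hz) 1
  have hψτ : ψ θ = lmap τ :=
    eq_of_meanMap_eq hμsupp (fun _ h => h.1) hQ (fun m hm => ⟨ψ m, hψ m hm⟩) hψQ (hQmem τ hτ)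
      hθ hψm hmean
  rw [hψτ]
  obtain ⟨y, hy, rfl⟩ := hlbij.surjOn hξ
  rw [hlinv1 y hy]
  obtain ⟨hvZ, hv⟩ := varOp_weak hμsupp (hQ _ (hQmem τ hτ)) (m := θ) hθ.1 hξ
  obtain ⟨hvtZ, hvt⟩ := varOp_weak hμtsupp hfint (hlstar θ hθ.1).1 hy
  have hstar : lstar (varOp μ (lmap τ) θ (lmap y)) = varOp μt τ (lstar θ) y := by
    refine eq_of_tip_eq (hlstar _ hvZ).1 hvtZ fun z hz => ?_
    rw [hadj _ hvZ z hz, hv _ (hlbij.mapsTo hz), hvt z hz]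
    simp_rw [tip_sub_right]
    rw [hadj θ hθ.1 y hy, hadj θ hθ.1 z hz]
    exact integral_mul_nef_eq lmap hfinL heqL hy hz _ _
  rw [← hstar, hlstarinv1 _ hvZ]

end Wishart
end

section
/- For every s ∈ ℝ^r and every x ∈ 𝒫: Δ_s(x) = (det x)^{s_r/n_r} · ∏_{k=1}^{r−1} (det x_{{1:k}})^{s_k/n_k − s_{k+1}/n_{k+1}}. In particular, for x = ρ(T)I_N with T ∈ H, det x_{{1:k}} = ∏_{i=1}^{k} t_{ii}^{2 n_i} > 0 for every k = 1,…,r. -/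
open Matrix MeasureTheory Finset
open scoped ENNReal

namespace Wishart

variable {r : ℕ} {n : Fin (r + 1) → ℕ+}

variable (V : ∀ l k : Fin (r + 1), Submodule ℝ (Matrix (Fin (n l)) (Fin (n k)) ℝ))

/-- **Cholesky decomposition** of a real positive definite matrix. -/
theorem exists_cholesky {ι : Type*} [Fintype ι] [LinearOrder ι] {x : Matrix ι ι ℝ}
    (hx : x.PosDef) :
    ∃ L : Matrix ι ι ℝ, L.IsLowerTriangular ∧ (∀ i, 0 < L i i) ∧ L * Lᵀ = x := by
  classical
  let _ : LocallyFiniteOrderBot ι := LocallyFiniteOrderBot.ofIic' ι (fun a => univ.filter (· ≤ a))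
    (by simp)
  have hlow : (LDL.lower hx).IsLowerTriangular :=
    blockTriangular_inv_of_blockTriangular
      (fun i j hij => LDL.lowerInv_triangular hx (OrderDual.toDual_lt_toDual.1 hij))
  have hnn : ∀ i, 0 ≤ LDL.diagEntries hx i := fun i => by
    have h := (hx.posSemidef.mul_mul_conjTranspose_same (LDL.lowerInv hx)).diag_nonneg (i := i)
    rwa [← LDL.diag_eq_lowerInv_conj, LDL.diag, diagonal_apply_eq] at h
  set L := LDL.lower hx * diagonal (fun i => √(LDL.diagEntries hx i)) with hL
  have hLtri : L.IsLowerTriangular := hlow.mul (blockTriangular_diagonal _)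
  have hLx : L * Lᵀ = x := by
    have h := LDL.lower_conj_diag hx
    rw [conjTranspose_eq_transpose_of_trivial] at h
    rw [hL, transpose_mul, diagonal_transpose, ← Matrix.mul_assoc,
      Matrix.mul_assoc (LDL.lower hx), diagonal_mul_diagonal]
    simp only [Real.mul_self_sqrt (hnn _)]
    exact h
  have hdiag : ∀ i, L i i ≠ 0 := by
    have h : L.det ≠ 0 := by
      intro h0
      have := hx.det_pos
      rw [← hLx, det_mul, h0, zero_mul] at this
      exact this.false
    rw [det_of_isLowerTriangular _ hLtri, Finset.prod_ne_zero_iff] at h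
    exact fun i => h i (mem_univ i)
  refine ⟨L * diagonal (fun i => ((SignType.sign (L i i) : SignType) : ℝ)),
    hLtri.mul (blockTriangular_diagonal _), fun i => ?_, ?_⟩
  · rw [mul_diagonal, self_mul_sign]
    exact abs_pos.2 (hdiag i)
  · have hs : ∀ i, ((SignType.sign (L i i) : SignType) : ℝ)
        * (SignType.sign (L i i) : SignType) = 1 := by
      intro i
      rcases (hdiag i).lt_or_gt with h | h <;> simp [h]
    rw [transpose_mul, diagonal_transpose, ← Matrix.mul_assoc, Matrix.mul_assoc L,
      diagonal_mul_diagonal]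
    simp only [hs, diagonal_one, Matrix.mul_one]
    exact hLx

/-- A lower triangular real matrix with positive diagonal which is a multiple of an orthogonal
matrix is scalar. -/
theorem exists_eq_smul_one_of_mul_transpose_eq {ι : Type*} [Fintype ι] [LinearOrder ι] [Nonempty ι]
    {M : Matrix ι ι ℝ} (htri : M.IsLowerTriangular) (hpos : ∀ i, 0 < M i i) {c : ℝ}
    (h : M * Mᵀ = c • (1 : Matrix ι ι ℝ)) :
    ∃ t : ℝ, 0 < t ∧ M = t • (1 : Matrix ι ι ℝ) := by
  have hentry : ∀ i, ∑ j, M i j * M i j = c := fun i => by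
    have := congrFun (congrFun h i) i
    simpa [mul_apply] using this
  have hc : 0 < c := by
    obtain ⟨i⟩ := ‹Nonempty ι›
    rw [← hentry i]
    exact Finset.sum_pos' (fun j _ => mul_self_nonneg _) ⟨i, mem_univ i, mul_pos (hpos i) (hpos i)⟩
  have hinv : M * (c⁻¹ • Mᵀ) = 1 := by
    rw [Matrix.mul_smul, h, smul_smul, inv_mul_cancel₀ hc.ne', one_smul]
  have hMinv : M⁻¹ = c⁻¹ • Mᵀ := inv_eq_right_inv hinv
  let _ : Invertible M := invertibleOfRightInverse M _ hinv
  have htri' := blockTriangular_inv_of_blockTriangular htri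
  rw [hMinv] at htri'
  have hoff : ∀ i j, i ≠ j → M i j = 0 := by
    intro i j hij
    rcases hij.lt_or_gt with h' | h'
    · exact htri (OrderDual.toDual_lt_toDual.2 h')
    · have := htri' (OrderDual.toDual_lt_toDual.2 h')
      simpa [hc.ne'] using this
  refine ⟨√c, Real.sqrt_pos.2 hc, ?_⟩
  ext i j
  by_cases hij : i = j
  · subst hij
    have h2 := hentry i
    rw [Finset.sum_eq_single i (fun j _ hj => by simp [hoff i j hj.symm]) (by simp)] at h2
    simp [← h2, Real.sqrt_mul_self (hpos i).le]
  · simp [hoff i j hij, hij]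

/-- The lexicographic linear order on the partitioned index set. -/
abbrev idxLexOrder (r : ℕ) (n : Fin (r + 1) → ℕ+) : LinearOrder (Idx r n) :=
  LinearOrder.lift' (fun p => (toLex p : Σₗ k : Fin (r + 1), Fin (n k))) toLex.injective

theorem idxLexOrder_lt_of_fst_lt {p q : Idx r n} (h : p.1 < q.1) : (idxLexOrder r n).lt p q :=
  Sigma.Lex.lt_def.2 (Or.inl h)

theorem idxLexOrder_lt_of_snd_lt {k : Fin (r + 1)} {a b : Fin (n k)} (h : a < b) :
    (idxLexOrder r n).lt ⟨k, a⟩ ⟨k, b⟩ :=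
  Sigma.Lex.lt_def.2 (Or.inr ⟨rfl, h⟩)

theorem idxLexOrder_lt_cases {p q : Idx r n} (h : (idxLexOrder r n).lt p q) :
    p.1 < q.1 ∨ p.1 = q.1 ∧ p ≠ q := by
  rcases Sigma.Lex.lt_def.1 h with h' | ⟨h', -⟩
  · exact Or.inl h'
  · refine Or.inr ⟨h', ?_⟩
    rintro rfl
    exact (@lt_irrefl _ (idxLexOrder r n).toPreorder _ h).elim

theorem blk_mul_transpose (A B : Mat r n) (l k : Fin (r + 1)) :
    blk (A * Bᵀ) l k = ∑ i, blk A l i * (blk B k i)ᵀ := by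
  ext a b
  simp [blk, mul_apply, Matrix.sum_apply, Fintype.sum_sigma]

/-- The `(l,k)` block of `L Lᵀ` for block lower triangular `L`. -/
theorem blk_mul_transpose_of_lower {L : Mat r n}
    (hlow : ∀ k l : Fin (r + 1), l < k → blk L l k = 0) (l k : Fin (r + 1)) :
    blk (L * Lᵀ) l k
      = ∑ i ∈ univ.filter (· < k), blk L l i * (blk L k i)ᵀ + blk L l k * (blk L k k)ᵀ := by
  rw [blk_mul_transpose, ← Finset.sum_filter_add_sum_filter_not univ (· < k)]
  congr 1
  refine Finset.sum_eq_single_of_mem k (by simp) fun i hi hik => ?_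
  have : k < i := lt_of_le_of_ne (by simpa using hi) hik.symm
  simp [hlow i k this]

/-- Every element of the cone `𝒫` is `ρ(T) I` for some `T ∈ H`. -/
theorem exists_mem_Hgrp_rhoM
    {V : ∀ l k : Fin (r + 1), Submodule ℝ (Matrix (Fin (n l)) (Fin (n k)) ℝ)}
    (hV2 : CondV2 V) (hV3 : CondV3 V) {x : Mat r n} (hx : x ∈ Pcone V) :
    ∃ T ∈ Hgrp V, x = rhoM T 1 := by
  obtain ⟨⟨-, hxV, hxd⟩, hpd⟩ := hx
  obtain ⟨L, htri, hpos, hL⟩ := @exists_cholesky _ _ (idxLexOrder r n) x hpd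
  have hlow : ∀ k l : Fin (r + 1), l < k → blk L l k = 0 := by
    intro k l hlk
    ext a b
    exact htri (idxLexOrder_lt_of_fst_lt (p := ⟨l, a⟩) (q := ⟨k, b⟩) hlk)
  have hblk := fun l k => hL ▸ blk_mul_transpose_of_lower hlow l k
  have key : ∀ k : Fin (r + 1), (∃ t : ℝ, 0 < t ∧ blk L k k = t • (1 : Matrix _ _ ℝ)) ∧
      ∀ l, k < l → blk L l k ∈ V l k := by
    intro k
    induction k using WellFoundedLT.induction with
    | ind k ih =>
      have hdiag : ∃ t : ℝ, 0 < t ∧ blk L k k = t • (1 : Matrix _ _ ℝ) := by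
        have hsum : ∃ c : ℝ, ∑ i ∈ univ.filter (· < k), blk L k i * (blk L k i)ᵀ
            = c • (1 : Matrix (Fin (n k)) (Fin (n k)) ℝ) := by
          have h : ∀ i, ∃ c : ℝ, i < k → blk L k i * (blk L k i)ᵀ
              = c • (1 : Matrix (Fin (n k)) (Fin (n k)) ℝ) := fun i => by
            by_cases hi : i < k
            · obtain ⟨c, hc⟩ := hV3 i k hi _ ((ih i hi).2 k hi)
              exact ⟨c, fun _ => hc⟩
            · exact ⟨0, fun h => absurd h hi⟩
          choose c hc using h
          refine ⟨∑ i ∈ univ.filter (· < k), c i, ?_⟩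
          rw [Finset.sum_smul]
          exact Finset.sum_congr rfl fun i hi => hc i (by simpa using hi)
        obtain ⟨c, hc⟩ := hsum
        obtain ⟨d, hd⟩ := hxd k
        have hxk : blk x k k = d • (1 : Matrix (Fin (n k)) (Fin (n k)) ℝ) := by
          ext a b
          simp [blk, hd, Matrix.one_apply]
        have h := hblk k k
        rw [hc, hxk] at h
        refine exists_eq_smul_one_of_mul_transpose_eq (c := d - c) (fun a b hab => ?_)
          (fun a => hpos ⟨k, a⟩) (by rw [sub_smul, h, add_sub_cancel_left])
        exact htri (idxLexOrder_lt_of_snd_lt (OrderDual.toDual_lt_toDual.1 hab))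
      refine ⟨hdiag, fun l hl => ?_⟩
      obtain ⟨t, ht, htk⟩ := hdiag
      have h := hblk l k
      rw [htk, transpose_smul, transpose_one, Matrix.mul_smul, Matrix.mul_one] at h
      have hmem : t • blk L l k ∈ V l k := by
        rw [← sub_eq_iff_eq_add'.2 h]
        refine (V l k).sub_mem (hxV k l hl) ((V l k).sum_mem fun i hi => ?_)
        have hi' : i < k := by simpa using hi
        exact hV2 i k l hi' hl _ ((ih i hi').2 l (hi'.trans hl)) _ ((ih i hi').2 k hi')
      exact ((V l k).smul_mem_iff ht.ne').1 hmem
  refine ⟨L, ⟨hlow, fun k l hkl => (key k).2 l hkl, fun k => ?_⟩, by simp [rhoM, hL]⟩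
  obtain ⟨t, ht, h⟩ := (key k).1
  refine ⟨t, ht, fun a b => ?_⟩
  have := congrFun (congrFun h a) b
  simpa [blk, Matrix.one_apply] using this

theorem tdiag_pos {V : ∀ l k : Fin (r + 1), Submodule ℝ (Matrix (Fin (n l)) (Fin (n k)) ℝ)}
    {T : Mat r n} (hT : T ∈ Hgrp V) (k : Fin (r + 1)) : 0 < tdiag T k := by
  obtain ⟨t, ht, h⟩ := hT.2.2 k
  simpa [tdiag, h] using ht

theorem apply_eq_tdiag {V : ∀ l k : Fin (r + 1), Submodule ℝ (Matrix (Fin (n l)) (Fin (n k)) ℝ)}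
    {T : Mat r n} (hT : T ∈ Hgrp V) (k : Fin (r + 1)) (a b : Fin (n k)) :
    T ⟨k, a⟩ ⟨k, b⟩ = if a = b then tdiag T k else 0 := by
  obtain ⟨t, -, h⟩ := hT.2.2 k
  simp [tdiag, h]

theorem apply_eq_zero_of_fst_lt
    {V : ∀ l k : Fin (r + 1), Submodule ℝ (Matrix (Fin (n l)) (Fin (n k)) ℝ)}
    {T : Mat r n} (hT : T ∈ Hgrp V) {p q : Idx r n} (h : p.1 < q.1) : T p q = 0 :=
  congrFun (congrFun (hT.1 q.1 p.1 h) p.2) q.2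

theorem lead_rhoM_one {V : ∀ l k : Fin (r + 1), Submodule ℝ (Matrix (Fin (n l)) (Fin (n k)) ℝ)}
    {T : Mat r n} (hT : T ∈ Hgrp V) (k : Fin (r + 1)) :
    lead k (rhoM T 1) = lead k T * (lead k T)ᵀ := by
  ext p q
  simp only [lead, rhoM, Matrix.mul_one, of_apply, mul_apply, transpose_apply]
  rw [← Finset.sum_subtype (univ.filter fun m : Idx r n => m.1 ≤ k) (by simp)
    (fun m => T p.1 m * T q.1 m), Finset.sum_filter]
  refine Finset.sum_congr rfl fun m _ => ?_
  split_ifs with hm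
  · rfl
  · rw [apply_eq_zero_of_fst_lt hT (p.2.trans_lt (not_le.1 hm)), zero_mul]

theorem det_lead_of_mem_Hgrp
    {V : ∀ l k : Fin (r + 1), Submodule ℝ (Matrix (Fin (n l)) (Fin (n k)) ℝ)}
    {T : Mat r n} (hT : T ∈ Hgrp V) (k : Fin (r + 1)) :
    (lead k T).det = ∏ i ∈ univ.filter (fun i => i ≤ k), tdiag T i ^ (n i : ℕ) := by
  let ord : LinearOrder {p : Idx r n // p.1 ≤ k} :=
    @LinearOrder.lift' _ _ (idxLexOrder r n) Subtype.val Subtype.val_injective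
  have htri : @IsLowerTriangular _ ℝ _ ord.toLT (lead k T) := by
    rintro ⟨⟨i, a⟩, hp⟩ ⟨⟨j, b⟩, hq⟩ hpq
    rcases idxLexOrder_lt_cases (p := ⟨i, a⟩) (q := ⟨j, b⟩) hpq with h | ⟨h, hne⟩
    · exact apply_eq_zero_of_fst_lt hT h
    · obtain rfl : i = j := h
      refine (apply_eq_tdiag hT i a b).trans (if_neg ?_)
      rintro rfl
      exact hne rfl
  have hd : ∀ p : Idx r n, T p p = tdiag T p.1 := fun p => by
    simpa using apply_eq_tdiag hT p.1 p.2 p.2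
  rw [@det_of_isLowerTriangular _ ℝ _ _ _ ord _ htri]
  simp only [lead, of_apply, hd]
  rw [← Finset.prod_subtype (univ.filter fun p : Idx r n => p.1 ≤ k) (by simp)
    (fun p => tdiag T p.1), Finset.prod_filter, Fintype.prod_sigma, Finset.prod_filter]
  exact Finset.prod_congr rfl fun i _ => by split_ifs <;> simp

theorem det_lead_rhoM_one
    {V : ∀ l k : Fin (r + 1), Submodule ℝ (Matrix (Fin (n l)) (Fin (n k)) ℝ)}
    {T : Mat r n} (hT : T ∈ Hgrp V) (k : Fin (r + 1)) :
    (lead k (rhoM T 1)).det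
      = ∏ i ∈ univ.filter (fun i => i ≤ k), tdiag T i ^ (2 * (n i : ℕ)) := by
  rw [lead_rhoM_one hT, det_mul, det_transpose, det_lead_of_mem_Hgrp hT, ← Finset.prod_mul_distrib]
  exact Finset.prod_congr rfl fun i _ => by rw [← pow_add, two_mul]

theorem det_lead_last (x : Mat r n) : (lead (Fin.last r) x).det = x.det := by
  rw [← det_submatrix_equiv_self (Equiv.subtypeUnivEquiv fun p : Idx r n => Fin.le_last p.1) x]
  rfl

/-- Summation by parts, in multiplicative form, for real powers of partial products. -/
theorem prod_rpow_eq_of_partial_prod {r : ℕ} {a D : Fin (r + 1) → ℝ} (ha : ∀ k, 0 < a k)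
    (hD : ∀ k, D k = ∏ i ∈ univ.filter (fun i => i ≤ k), a i) (σ : Fin (r + 1) → ℝ) :
    ∏ k, a k ^ σ k = D (Fin.last r) ^ σ (Fin.last r)
      * ∏ j : Fin r, D j.castSucc ^ (σ j.castSucc - σ j.succ) := by
  have hDpos : ∀ k, 0 < D k := fun k => hD k ▸ Finset.prod_pos fun i _ => ha i
  have hD0 : D 0 = a 0 := by
    rw [hD, Finset.prod_eq_single_of_mem 0 (by simp)]
    intro i hi hi0
    exact absurd (Fin.le_zero_iff.1 (by simpa using hi)) hi0
  have hDs : ∀ j : Fin r, D j.succ = a j.succ * D j.castSucc := by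
    intro j
    rw [hD, hD, ← Finset.prod_insert (by simp)]
    congr 1
    ext i
    simp only [mem_filter, mem_univ, true_and, mem_insert, Fin.le_def, Fin.ext_iff, Fin.val_succ,
      Fin.val_castSucc]
    omega
  simp only [Real.rpow_sub (hDpos _), Finset.prod_div_distrib]
  rw [mul_div_assoc', mul_comm (D (Fin.last r) ^ _),
    ← Fin.prod_univ_castSucc (fun k => D k ^ σ k), Fin.prod_univ_succ, Fin.prod_univ_succ, hD0,
    eq_div_iff (Finset.prod_ne_zero_iff.2 fun j _ => (Real.rpow_pos_of_pos (hDpos _) _).ne'),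
    mul_assoc, ← Finset.prod_mul_distrib]
  congr 1
  exact Finset.prod_congr rfl fun j _ => by
    rw [hDs, Real.mul_rpow (ha _).le (hDpos _).le]

/-- For every `s ∈ ℝ^r` and every `x ∈ 𝒫`:
`Δ_s(x) = (det x)^{s_r/n_r} ∏_{k<r} (det x_{1:k})^{s_k/n_k - s_{k+1}/n_{k+1}}`.
In particular, for `x = ρ(T) I` with `T ∈ H`, `det x_{1:k} = ∏_{i≤k} t_{ii}^{2 n_i} > 0`
for every `k`. -/
theorem statement18 (r : ℕ) (n : Fin (r + 1) → ℕ+)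
    (V : ∀ l k : Fin (r + 1), Submodule ℝ (Matrix (Fin (n l)) (Fin (n k)) ℝ))
    (hV1 : CondV1 V) (hV2 : CondV2 V) (hV3 : CondV3 V)
    (Δf : (Fin (r + 1) → ℝ) → Mat r n → ℝ)
    (hΔ : ∀ s : Fin (r + 1) → ℝ, ∀ T ∈ Hgrp V, Δf s (rhoM T 1) = chi s T) :
    (∀ (s : Fin (r + 1) → ℝ), ∀ x ∈ Pcone V,
      Δf s x = x.det ^ (s (Fin.last r) / ((n (Fin.last r) : ℕ) : ℝ))
        * ∏ j : Fin r, (lead j.castSucc x).det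
            ^ (s j.castSucc / ((n j.castSucc : ℕ) : ℝ)
              - s j.succ / ((n j.succ : ℕ) : ℝ))) ∧
    ∀ T ∈ Hgrp V, ∀ k : Fin (r + 1),
      (lead k (rhoM T 1)).det
          = ∏ i ∈ Finset.univ.filter (fun i => i ≤ k), tdiag T i ^ (2 * (n i : ℕ)) ∧
      0 < (lead k (rhoM T 1)).det := by
  have hdet := fun T hT => det_lead_rhoM_one (V := V) (T := T) hT
  refine ⟨fun s x hx => ?_, fun T hT k => ⟨hdet T hT k, ?_⟩⟩
  · obtain ⟨T, hT, rfl⟩ := exists_mem_Hgrp_rhoM hV2 hV3 hx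
    rw [hΔ s T hT, ← det_lead_last]
    rw [← prod_rpow_eq_of_partial_prod (D := fun k => (lead k (rhoM T 1)).det)
      (σ := fun k => s k / ((n k : ℕ) : ℝ))
      (fun k => pow_pos (tdiag_pos hT k) _) (hdet T hT)]
    refine Finset.prod_congr rfl fun k _ => ?_
    have hn : ((n k : ℕ) : ℝ) ≠ 0 := Nat.cast_ne_zero.2 (n k).ne_zero
    rw [← Real.rpow_natCast, ← Real.rpow_mul (tdiag_pos hT k).le]
    congr 1
    push_cast
    field_simp
  · rw [hdet T hT k]
    exact Finset.prod_pos fun i _ => pow_pos (tdiag_pos hT i) _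

end Wishart
end
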